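/- Let w ∈ (0,1), let K ≥ 0 be an integer, let A₀,…,A_K > 0, and let g : ℝ → ℝ be a C^K function with sup_{t∈ℝ} (1+|t|)^{k+w} |∂_t^k g(t)| ≤ A_k for each 0 ≤ k ≤ K. Let v(x,Y) = ∫_ℝ P_Y(x−t) g(t) dt. Then for each 0 ≤ k ≤ K there is a constant C(k, w, A₀,…,A_k) such that sup_{Y>0} |∂_x^k v(x,Y)| ≤ C(k, w, A₀,…,A_k) x^{−k−w} for all x ≥ 1. -/

import Mathlib

open MeasureTheory

/-- The Poisson extension of `g` to the upper half-plane with the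
(unnormalized) kernel `P_Y(x) = Y/(Y² + x²)`. -/
noncomputable def poissonExt (g : ℝ → ℝ) (x Y : ℝ) : ℝ :=
  ∫ t : ℝ, (Y / (Y^2 + (x - t)^2)) * g t

/-- The `j`-th derivative of the Poisson kernel. -/
noncomputable def pker (Y : ℝ) (j : ℕ) (s : ℝ) : ℝ :=
  (((-1) ^ (j + 1) * (j.factorial : ℂ)) * (((s : ℂ) + Y * Complex.I) ^ (j + 1))⁻¹).im

lemma pker_base_ne {Y : ℝ} (hY : 0 < Y) (s : ℝ) : (s : ℂ) + Y * Complex.I ≠ 0 := by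
  intro h
  have := congrArg Complex.im h
  simp at this
  exact hY.ne' this

lemma pker_zero {Y : ℝ} (s : ℝ) : pker Y 0 s = Y / (Y ^ 2 + s ^ 2) := by
  simp [pker, Complex.inv_im, Complex.normSq_apply]
  ring_nf

lemma pker_hasDerivAt {Y : ℝ} (hY : 0 < Y) (j : ℕ) (s : ℝ) :
    HasDerivAt (pker Y j) (pker Y (j + 1) s) s := by
  have h0 := pker_base_ne hY s
  have h1 : HasDerivAt (fun s : ℝ => (s : ℂ) + Y * Complex.I) 1 s :=
    (Complex.ofRealCLM.hasDerivAt (x := s)).add_const _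
  have h2 := ((h1.pow (j + 1)).inv (pow_ne_zero _ h0)).const_mul
    ((-1) ^ (j + 1) * (j.factorial : ℂ))
  have h3 := Complex.imCLM.hasFDerivAt.comp_hasDerivAt s h2
  refine h3.congr_deriv ?_
  simp only [pker, Complex.imCLM_apply]
  congr 1
  simp only [Nat.factorial_succ, Pi.pow_apply]
  push_cast
  field_simp
  simp [pow_succ]
  try ring

lemma pker_continuous {Y : ℝ} (hY : 0 < Y) (j : ℕ) : Continuous (pker Y j) :=
  continuous_iff_continuousAt.2 fun s => (pker_hasDerivAt hY j s).continuousAt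

lemma pker_norm {Y : ℝ} (j : ℕ) (s : ℝ) :
    |pker Y j s| ≤ j.factorial * (‖(s : ℂ) + Y * Complex.I‖ ^ (j + 1))⁻¹ := by
  refine (Complex.abs_im_le_norm _).trans ?_
  simp

lemma pker_bound {Y : ℝ} (j : ℕ) {s : ℝ} (hs : s ≠ 0) :
    |pker Y j s| ≤ j.factorial * (|s| ^ (j + 1))⁻¹ := by
  refine (pker_norm j s).trans ?_
  have : |s| ≤ ‖(s : ℂ) + Y * Complex.I‖ := by
    have := Complex.abs_re_le_norm ((s : ℂ) + Y * Complex.I)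
    simpa using this
  have := abs_pos.2 hs
  gcongr

lemma P_eq {Y : ℝ} (hY : 0 < Y) (s : ℝ) :
    Y / (Y ^ 2 + s ^ 2) = Y⁻¹ * (1 + (s / Y) ^ 2)⁻¹ := by
  field_simp

lemma P_integrable {Y : ℝ} (hY : 0 < Y) : Integrable (fun s : ℝ => Y / (Y ^ 2 + s ^ 2)) := by
  simp_rw [P_eq hY]
  exact (integrable_inv_one_add_sq.comp_div hY.ne').const_mul _

lemma P_integral {Y : ℝ} (hY : 0 < Y) : ∫ s : ℝ, Y / (Y ^ 2 + s ^ 2) = Real.pi := by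
  simp_rw [P_eq hY]
  rw [integral_const_mul, Measure.integral_comp_div (fun s : ℝ => (1 + s ^ 2)⁻¹) Y,
    integral_univ_inv_one_add_sq, abs_of_pos hY, smul_eq_mul]
  field_simp

lemma pker_integrable {Y : ℝ} (hY : 0 < Y) (j : ℕ) : Integrable (pker Y j) := by
  rcases j with _ | j
  · have : pker Y 0 = fun s => Y / (Y ^ 2 + s ^ 2) := by ext s; exact pker_zero s
    rw [this]; exact P_integrable hY
  · refine ((P_integrable hY).const_mul ((j + 1).factorial * (Y ^ (j + 1))⁻¹)).mono'
      (pker_continuous hY _).aestronglyMeasurable (Filter.Eventually.of_forall fun s => ?_)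
    refine (pker_norm (j + 1) s).trans ?_
    have h1 : Y ≤ ‖(s : ℂ) + Y * Complex.I‖ := by
      have := Complex.abs_im_le_norm ((s : ℂ) + Y * Complex.I)
      simp only [Complex.add_im, Complex.ofReal_im, Complex.mul_im, Complex.ofReal_re,
        Complex.I_im, Complex.I_re, zero_add, mul_one, mul_zero, add_zero] at this
      exact (le_abs_self _).trans this
    have h2 : Y ^ 2 + s ^ 2 = ‖(s : ℂ) + Y * Complex.I‖ ^ 2 := by
      rw [← Complex.normSq_eq_norm_sq, Complex.normSq_apply]
      simp
      ring
    rw [h2]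
    set r := ‖(s : ℂ) + Y * Complex.I‖
    have hr : 0 < r := hY.trans_le h1
    rw [mul_assoc]
    gcongr
    have e : (r ^ (j + 1 + 1))⁻¹ = (r ^ j)⁻¹ * (r ^ 2)⁻¹ := by
      rw [← mul_inv]; ring_nf
    have e2 : (Y ^ (j + 1))⁻¹ * (Y / r ^ 2) = (Y ^ j)⁻¹ * (r ^ 2)⁻¹ := by
      rw [pow_succ]
      field_simp
    rw [e, e2]
    gcongr

/-- scale-invariant majorant -/
noncomputable def phi (w t : ℝ) : ℝ := (1 + |t|)⁻¹ * |t| ^ (-w)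

lemma phi_integrable {w : ℝ} (hw0 : 0 < w) (hw1 : w < 1) : Integrable (phi w) := by
  have hm : Measurable (phi w) := by unfold phi; fun_prop
  have h1 : IntegrableOn (phi w) (Set.Ioc 0 1) := by
    have := (intervalIntegral.intervalIntegrable_rpow' (a := 0) (b := 1) (r := -w) (by linarith))
    rw [intervalIntegrable_iff_integrableOn_Ioc_of_le zero_le_one] at this
    refine Integrable.mono' this hm.aestronglyMeasurable ?_
    refine (ae_restrict_iff' measurableSet_Ioc).2 (Filter.Eventually.of_forall fun t ht => ?_)
    have ht0 : 0 < t := ht.1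
    simp only [phi, abs_of_pos ht0]
    have := Real.rpow_nonneg ht0.le (-w)
    rw [Real.norm_of_nonneg (by positivity)]
    have h : (1 + t)⁻¹ ≤ 1 := inv_le_one_of_one_le₀ (by linarith)
    nlinarith
  have h2 : IntegrableOn (phi w) (Set.Ioi 1) := by
    have := integrableOn_Ioi_rpow_of_lt (a := -1 - w) (c := 1) (by linarith) one_pos
    refine Integrable.mono' this hm.aestronglyMeasurable ?_
    refine (ae_restrict_iff' measurableSet_Ioi).2 (Filter.Eventually.of_forall fun t ht => ?_)
    have ht0 : 0 < t := lt_trans one_pos ht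
    simp only [phi, abs_of_pos ht0]
    have := Real.rpow_nonneg ht0.le (-w)
    rw [Real.norm_of_nonneg (by positivity), sub_eq_add_neg, Real.rpow_add ht0,
      Real.rpow_neg_one]
    gcongr
    linarith
  have h3 : IntegrableOn (phi w) (Set.Ioi 0) := by
    rw [← Set.Ioc_union_Ioi_eq_Ioi (zero_le_one (α := ℝ))]
    exact h1.union h2
  have h4 : IntegrableOn (phi w) (Set.Iic 0) := by
    have : IntegrableOn (fun t => phi w (-t)) (Set.Iic 0) := by
      rw [← integrableOn_Ici_iff_integrableOn_Ioi] at h3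
      exact (integrableOn_Iic_iff_integrableOn_Iio).2 (by
        have := (Measure.measurePreserving_neg (volume : Measure ℝ)).integrableOn_comp_preimage
          (Homeomorph.neg ℝ).measurableEmbedding (f := phi w) (s := Set.Ioi 0)
        simpa [Function.comp_def] using this.2 (h3.mono_set Set.Ioi_subset_Ici_self))
    have e : (fun t => phi w (-t)) = phi w := by ext t; simp [phi]
    rwa [e] at this
  rw [← integrableOn_univ, ← Set.Iic_union_Ioi (a := (0:ℝ))]
  exact h4.union h3

lemma phi_scaled {w x : ℝ} (hx : 0 < x) (t : ℝ) :
    (x + |t|)⁻¹ * |t| ^ (-w) = x ^ (-w) * x⁻¹ * phi w (t / x) := by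
  unfold phi
  rw [abs_div, abs_of_pos hx, Real.div_rpow (abs_nonneg _) hx.le]
  have := Real.rpow_pos_of_pos hx (-w)
  field_simp

lemma phi_scaled_integrable {w x : ℝ} (hw0 : 0 < w) (hw1 : w < 1) (hx : 0 < x) :
    Integrable (fun s : ℝ => (x + |x - s|)⁻¹ * |x - s| ^ (-w)) := by
  simp_rw [phi_scaled hx]
  exact (((phi_integrable hw0 hw1).comp_div hx.ne').comp_sub_left x).const_mul _

lemma phi_scaled_integral {w x : ℝ} (hx : 0 < x) :
    ∫ s : ℝ, (x + |x - s|)⁻¹ * |x - s| ^ (-w) = x ^ (-w) * ∫ t, phi w t := by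
  simp_rw [phi_scaled hx]
  rw [integral_const_mul, integral_sub_left_eq_self (fun t => phi w (t / x)),
    Measure.integral_comp_div, abs_of_pos hx, smul_eq_mul]
  field_simp

lemma g_deriv {K : ℕ} {g : ℝ → ℝ} (hg : ContDiff ℝ K g) {m : ℕ} (hm : m + 1 ≤ K) (t : ℝ) :
    HasDerivAt (iteratedDeriv m g) (iteratedDeriv (m + 1) g t) t := by
  rw [iteratedDeriv_succ]
  exact (hg.differentiable_iteratedDeriv m (by exact_mod_cast hm) t).hasDerivAt

lemma g_cont {K : ℕ} {g : ℝ → ℝ} (hg : ContDiff ℝ K g) {m : ℕ} (hm : m ≤ K) :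
    Continuous (iteratedDeriv m g) :=
  hg.continuous_iteratedDeriv m (by exact_mod_cast hm)

/-- decay in every form needed -/
lemma decay {w a b y t : ℝ} (hw0 : 0 < w) (n : ℕ) (hy : 0 < y) (hyt : y ≤ 1 + |t|)
    (h : (1 + |t|) ^ ((n:ℝ) + w) * |b| ≤ a) : |b| ≤ |a| * y ^ (-(n:ℝ) - w) := by
  have h1 : 0 < (1 + |t|) := by positivity
  have h2 : y ^ ((n:ℝ) + w) ≤ (1 + |t|) ^ ((n:ℝ) + w) := by gcongr
  have h3 := Real.rpow_pos_of_pos hy ((n:ℝ) + w)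
  rw [show -(n:ℝ) - w = -((n:ℝ) + w) by ring, Real.rpow_neg hy.le, ← div_eq_mul_inv,
    le_div_iff₀ h3, mul_comm]
  exact ((mul_le_mul_of_nonneg_right h2 (abs_nonneg _)).trans h).trans (le_abs_self a)

lemma conv_integrable {Y : ℝ} (hY : 0 < Y) (j : ℕ) {f : ℝ → ℝ} (hf : Continuous f) {c : ℝ}
    (hb : ∀ t, |f t| ≤ c) (x : ℝ) : Integrable (fun s => pker Y j s * f (x - s)) :=
  (pker_integrable hY j).mul_bdd (c := c) (by fun_prop)
    (Filter.Eventually.of_forall fun s => hb _)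

lemma deriv_conv {Y : ℝ} (hY : 0 < Y) {f f' : ℝ → ℝ} (hf' : Continuous f')
    (hd : ∀ t, HasDerivAt f (f' t) t) {c c' : ℝ} (hb : ∀ t, |f t| ≤ c) (hb' : ∀ t, |f' t| ≤ c')
    (x : ℝ) : HasDerivAt (fun x => ∫ s, pker Y 0 s * f (x - s))
      (∫ s, pker Y 0 s * f' (x - s)) x := by
  have hf : Continuous f := continuous_iff_continuousAt.2 fun s => (hd s).continuousAt
  have hp := pker_continuous hY 0
  refine (hasDerivAt_integral_of_dominated_loc_of_deriv_le (s := Set.univ)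
    (F := fun x s => pker Y 0 s * f (x - s)) (F' := fun x s => pker Y 0 s * f' (x - s))
    (bound := fun s => |pker Y 0 s| * c') Filter.univ_mem
    (Filter.Eventually.of_forall fun y => (by fun_prop))
    (conv_integrable hY 0 hf hb x) (by fun_prop) ?_ ?_ ?_).2
  · refine Filter.Eventually.of_forall fun s y _ => ?_
    rw [norm_mul]
    exact mul_le_mul_of_nonneg_left (hb' _) (norm_nonneg _)
  · exact (pker_integrable hY 0).abs.mul_const _
  · refine Filter.Eventually.of_forall fun s y _ => ?_
    exact ((hd _).comp_sub_const y s).const_mul _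

lemma poisson_eq (g : ℝ → ℝ) (x Y : ℝ) :
    poissonExt g x Y = ∫ s, pker Y 0 s * g (x - s) := by
  unfold poissonExt
  rw [← integral_sub_left_eq_self _ volume x]
  simp [pker_zero]

lemma iter_conv {Y : ℝ} (hY : 0 < Y) {K : ℕ} {g : ℝ → ℝ} (hg : ContDiff ℝ K g) {c : ℕ → ℝ}
    (hc : ∀ m ≤ K, ∀ t, |iteratedDeriv m g t| ≤ c m) (k : ℕ) (hk : k ≤ K) :
    iteratedDeriv k (fun x' => poissonExt g x' Y) =
      fun x => ∫ s, pker Y 0 s * iteratedDeriv k g (x - s) := by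
  induction k with
  | zero => ext x; simp [poisson_eq]
  | succ k ih =>
    ext x
    rw [iteratedDeriv_succ, ih (by omega)]
    exact (deriv_conv hY (g_cont hg hk) (g_deriv hg hk) (hc k (by omega)) (hc _ hk) x).deriv

lemma by_parts {Y x : ℝ} (hY : 0 < Y) (j : ℕ) {f f' : ℝ → ℝ} (hf' : Continuous f')
    (hd : ∀ t, HasDerivAt f (f' t) t) {c c' : ℝ} (hb : ∀ t, |f t| ≤ c) (hb' : ∀ t, |f' t| ≤ c')
    (a b : ℝ) :
    (∫ s, pker Y j s * f' (x - s)) - ∫ s in a..b, pker Y j s * f' (x - s) =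
    ((∫ s, pker Y (j + 1) s * f (x - s)) - ∫ s in a..b, pker Y (j + 1) s * f (x - s)) +
      (pker Y j b * f (x - b) - pker Y j a * f (x - a)) := by
  have hf : Continuous f := continuous_iff_continuousAt.2 fun s => (hd s).continuousAt
  have hv : ∀ s, HasDerivAt (fun s => - f (x - s)) (f' (x - s)) s := fun s => by
    have := ((hd (x - s)).comp_const_sub x s).neg
    rw [neg_neg] at this
    exact this
  have hp := pker_continuous hY (j + 1)
  have e1 := integral_mul_deriv_eq_deriv_mul_of_integrable (u := pker Y j)
    (v := fun s => - f (x - s)) (fun s _ => pker_hasDerivAt hY j s) (fun s _ => hv s)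
    (conv_integrable hY j hf' hb' x)
    (conv_integrable hY (j + 1) (f := fun t => - f t) hf.neg (by simpa using hb) x)
    (conv_integrable hY j (f := fun t => - f t) hf.neg (by simpa using hb) x)
  have e2 := intervalIntegral.integral_mul_deriv_eq_deriv_mul (a := a) (b := b) (u := pker Y j)
    (v := fun s => - f (x - s)) (fun s _ => pker_hasDerivAt hY j s) (fun s _ => hv s)
    (hp.intervalIntegrable _ _)
    ((hf'.comp (continuous_const.sub continuous_id)).intervalIntegrable _ _)
  rw [e1, e2]
  simp only [mul_neg, integral_neg, intervalIntegral.integral_neg]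
  ring

lemma base_bound {w : ℝ} (hw0 : 0 < w) (hw1 : w < 1) (a : ℝ) (j : ℕ) :
    ∃ C ≥ (0:ℝ), ∀ g : ℝ → ℝ, Continuous g → (∀ t, (1 + |t|) ^ w * |g t| ≤ a) →
      ∀ x : ℝ, 1 ≤ x → ∀ Y : ℝ, 0 < Y →
      |(∫ s, pker Y j s * g (x - s)) - ∫ s in (-(x/2))..(x/2), pker Y j s * g (x - s)|
        ≤ C * x ^ (-(j:ℝ) - w) := by
  have hM : 0 ≤ ∫ t, phi w t := integral_nonneg fun t => by
    have := Real.rpow_nonneg (abs_nonneg t) (-w)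
    simp only [phi, Pi.zero_apply]; positivity
  refine ⟨j.factorial * 5 ^ (j + 1) * |a| * ∫ t, phi w t, by positivity, ?_⟩
  intro g hg hb x hx Y hY
  have hx0 : 0 < x := by linarith
  have hgb : ∀ t, |g t| ≤ |a| := fun t => by
    have := decay (y := 1) hw0 0 one_pos (by simp) (by simpa using hb t)
    simpa using this
  have hi := conv_integrable hY j hg hgb x
  rw [intervalIntegral.integral_of_le (by linarith),
    ← integral_add_compl (measurableSet_Ioc (a := -(x/2)) (b := x/2)) hi, add_sub_cancel_left]
  set c : ℝ := j.factorial * 5 ^ (j + 1) * |a| * (x ^ j)⁻¹ with hcdef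
  have hc : 0 ≤ c := by positivity
  have hint := (phi_scaled_integrable hw0 hw1 hx0).const_mul c
  have key : ∀ᵐ s ∂(volume.restrict (Set.Ioc (-(x/2)) (x/2))ᶜ),
      ‖pker Y j s * g (x - s)‖ ≤ c * ((x + |x - s|)⁻¹ * |x - s| ^ (-w)) := by
    have hne : ∀ᵐ s ∂(volume : Measure ℝ), s ≠ x := by
      simp [ae_iff]
    refine (ae_restrict_iff' measurableSet_Ioc.compl).2 (hne.mono fun s hsx hs => ?_)
    have hs' : x / 2 ≤ |s| := by
      by_contra h
      rw [not_le, abs_lt] at h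
      exact hs ⟨h.1, h.2.le⟩
    have hs0 : 0 < |s| := by linarith
    have hxs : 0 < |x - s| := abs_pos.2 (sub_ne_zero.2 hsx.symm)
    have h1 := pker_bound (Y := Y) j (abs_pos.1 hs0)
    have h2 : |g (x - s)| ≤ |a| * |x - s| ^ (-w) := by
      have := decay (y := |x - s|) (t := x - s) hw0 0 hxs (by linarith) (by simpa using hb (x - s))
      simpa using this
    have h3 : |x - s| ≤ x + |s| := by
      have := abs_sub x s; rwa [abs_of_pos hx0] at this
    have h4 : (|s| ^ (j + 1))⁻¹ ≤ 5 ^ (j + 1) * ((x ^ j)⁻¹ * (x + |x - s|)⁻¹) := by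
      have h5 : x ^ j * (x + |x - s|) ≤ (5 * |s|) ^ (j + 1) := by
        rw [pow_succ]
        gcongr <;> linarith
      rw [← mul_inv, ← div_eq_mul_inv, inv_eq_one_div, div_le_div_iff₀ (by positivity)
        (by positivity), ← mul_pow, one_mul]
      exact h5
    have h6 := Real.rpow_nonneg hxs.le (-w)
    rw [norm_mul, Real.norm_eq_abs, Real.norm_eq_abs]
    calc |pker Y j s| * |g (x - s)|
        ≤ (j.factorial * (5 ^ (j + 1) * ((x ^ j)⁻¹ * (x + |x - s|)⁻¹))) *
          (|a| * |x - s| ^ (-w)) := by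
          refine mul_le_mul (h1.trans ?_) h2 (abs_nonneg _) (by positivity)
          gcongr
      _ = _ := by rw [hcdef]; ring
  have := norm_integral_le_of_norm_le hint.integrableOn key
  refine this.trans ((setIntegral_le_integral hint ?_).trans ?_)
  · refine Filter.Eventually.of_forall fun s => ?_
    have := Real.rpow_nonneg (abs_nonneg (x - s)) (-w)
    simp only [Pi.zero_apply]; positivity
  · rw [integral_const_mul, phi_scaled_integral hx0, sub_eq_add_neg, Real.rpow_add hx0,
      Real.rpow_neg hx0.le (j:ℝ), Real.rpow_natCast, hcdef]
    apply le_of_eq; ring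

lemma far_bound {w : ℝ} (hw0 : 0 < w) (hw1 : w < 1) (K : ℕ) (A : ℕ → ℝ) (m : ℕ) (hm : m ≤ K) :
    ∀ j : ℕ, ∃ C ≥ (0:ℝ), ∀ g : ℝ → ℝ, ContDiff ℝ K g →
        (∀ j : ℕ, j ≤ K →
          ∀ t : ℝ, (1 + |t|) ^ ((j:ℝ) + w) * |iteratedDeriv j g t| ≤ A j) →
      ∀ x : ℝ, 1 ≤ x → ∀ Y : ℝ, 0 < Y →
      |(∫ s, pker Y j s * iteratedDeriv m g (x - s)) -
        ∫ s in (-(x/2))..(x/2), pker Y j s * iteratedDeriv m g (x - s)|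
        ≤ C * x ^ (-((j + m : ℕ):ℝ) - w) := by
  induction m with
  | zero =>
    intro j
    obtain ⟨C, hC, h⟩ := base_bound hw0 hw1 (A 0) j
    refine ⟨C, hC, fun g hg hA x hx Y hY => ?_⟩
    simpa using h g hg.continuous (by simpa using hA 0 (by omega)) x hx Y hY
  | succ m ih =>
    intro j
    obtain ⟨C, hC, h⟩ := ih (by omega) (j + 1)
    set B : ℝ := j.factorial * 2 ^ (j + 1) * (|A m| * (2⁻¹ : ℝ) ^ (-(m:ℝ) - w)) with hB
    have hB0 : 0 ≤ B := by positivity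
    refine ⟨C + 2 * B, by positivity, fun g hg hA x hx Y hY => ?_⟩
    have hx0 : 0 < x := by linarith
    have hb : ∀ i ≤ K, ∀ t, |iteratedDeriv i g t| ≤ |A i| := fun i hi t => by
      have := decay (y := 1) hw0 i one_pos (by simp) (hA i hi t)
      simpa using this
    rw [by_parts hY j (g_cont hg hm) (g_deriv hg hm) (hb m (by omega)) (hb _ hm)]
    have hbd : ∀ s, |s| = x / 2 → |pker Y j s * iteratedDeriv m g (x - s)| ≤
        B * x ^ (-((j + (m + 1) : ℕ):ℝ) - w) := by
      intro s hs
      have hs0 : 0 < |s| := by rw [hs]; linarith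
      have h1 := pker_bound (Y := Y) j (abs_pos.1 hs0)
      have h2 := decay (y := 2⁻¹ * x) (t := x - s) hw0 m (by positivity) (by
        have := le_abs_self (x - s); have := le_abs_self s; linarith) (hA m (by omega) (x - s))
      rw [abs_mul]
      refine (mul_le_mul h1 h2 (abs_nonneg _) (by positivity)).trans (le_of_eq ?_)
      rw [hs, Real.mul_rpow (by norm_num) hx0.le, hB,
        show -((j + (m + 1) : ℕ):ℝ) - w = -((j + 1 : ℕ) : ℝ) + (-(m:ℝ) - w) by push_cast; ring,
        Real.rpow_add hx0 (-((j + 1 : ℕ) : ℝ)), Real.rpow_neg hx0.le ((j + 1 : ℕ) : ℝ),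
        Real.rpow_natCast, div_pow, inv_div]
      ring
    have e1 := hbd (x / 2) (abs_of_pos (by linarith))
    have e2 := hbd (-(x / 2)) (by rw [abs_neg]; exact abs_of_pos (by linarith))
    have e3 := h g hg hA x hx Y hY
    rw [show j + 1 + m = j + (m + 1) by ring] at e3
    refine (abs_add_le _ _).trans ?_
    have e4 := abs_sub (pker Y j (x / 2) * iteratedDeriv m g (x - x / 2))
      (pker Y j (-(x / 2)) * iteratedDeriv m g (x - -(x / 2)))
    linarith

theorem stmt6 (w : ℝ) (hw0 : 0 < w) (hw1 : w < 1) (K : ℕ) (A : ℕ → ℝ) :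
    ∀ k : ℕ, k ≤ K → ∃ C > (0:ℝ),
      ∀ g : ℝ → ℝ, ContDiff ℝ K g →
        (∀ j : ℕ, j ≤ K →
          ∀ t : ℝ, (1 + |t|) ^ ((j:ℝ) + w) * |iteratedDeriv j g t| ≤ A j) →
        ∀ x : ℝ, 1 ≤ x → ∀ Y : ℝ, 0 < Y →
          |iteratedDeriv k (fun x' => poissonExt g x' Y) x| ≤ C * x ^ (-(k:ℝ) - w) := by
  intro k hk
  obtain ⟨C, hC, h⟩ := far_bound hw0 hw1 K A k hk 0
  set B : ℝ := Real.pi * (|A k| * (2⁻¹ : ℝ) ^ (-(k:ℝ) - w)) with hB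
  have hB0 : 0 ≤ B := by positivity
  refine ⟨C + B + 1, by positivity, fun g hg hA x hx Y hY => ?_⟩
  have hx0 : 0 < x := by linarith
  have hb : ∀ i ≤ K, ∀ t, |iteratedDeriv i g t| ≤ |A i| := fun i hi t => by
    have := decay (y := 1) hw0 i one_pos (by simp) (hA i hi t)
    simpa using this
  rw [iter_conv hY hg hb k hk]
  have e1 := h g hg hA x hx Y hY
  rw [zero_add] at e1
  have e2 : |∫ s in (-(x/2))..(x/2), pker Y 0 s * iteratedDeriv k g (x - s)| ≤
      B * x ^ (-(k:ℝ) - w) := by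
    rw [intervalIntegral.integral_of_le (by linarith)]
    set c := |A k| * (2⁻¹ * x) ^ (-(k:ℝ) - w) with hc
    have hint := (P_integrable hY).mul_const c
    have key : ∀ᵐ s ∂(volume.restrict (Set.Ioc (-(x/2)) (x/2))),
        ‖pker Y 0 s * iteratedDeriv k g (x - s)‖ ≤ Y / (Y ^ 2 + s ^ 2) * c := by
      refine (ae_restrict_iff' measurableSet_Ioc).2 (Filter.Eventually.of_forall fun s hs => ?_)
      have h2 := decay (y := 2⁻¹ * x) (t := x - s) hw0 k (by positivity) (by
        have := le_abs_self (x - s); have := hs.2; linarith) (hA k hk (x - s))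
      rw [pker_zero, norm_mul, Real.norm_of_nonneg (by positivity)]
      exact mul_le_mul_of_nonneg_left h2 (by positivity)
    have := norm_integral_le_of_norm_le hint.integrableOn key
    refine this.trans ((setIntegral_le_integral hint ?_).trans (le_of_eq ?_))
    · refine Filter.Eventually.of_forall fun s => ?_
      simp only [Pi.zero_apply]; positivity
    · rw [integral_mul_const, P_integral hY, hB, hc, Real.mul_rpow (by norm_num) hx0.le]
      ring
  have e3 := Real.rpow_nonneg hx0.le (-(k:ℝ) - w)
  have e4 := abs_add_le ((∫ s, pker Y 0 s * iteratedDeriv k g (x - s)) -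
        ∫ s in (-(x/2))..(x/2), pker Y 0 s * iteratedDeriv k g (x - s))
        (∫ s in (-(x/2))..(x/2), pker Y 0 s * iteratedDeriv k g (x - s))
  rw [sub_add_cancel] at e4
  simp only
  linarith
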